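/- arXiv:1804.07989 — 2 statements merged into one kernel-verified Lean document; each statement's English description precedes it below -/
import Mathlib

section
/- For all integers m ≥ 2 and α ≥ 0, S(m,α) = m! · Σ_{r=0}^{m−2} Σ 2^{2(r+1)−m−α} · ζ(a₁,…,a_r,α+2), where the inner sum runs over all tuples (a₁,…,a_r) ∈ {1,2}^r with a₁+⋯+a_r = m−2 (for r = 0 the empty tuple contributes the term 2^{2−m−α}·ζ(α+2), which occurs exactly when m = 2). In particular S(m,α) lies in the ℚ-span of multiple zeta values. -/
open scoped Nat
open Finset

/-- The multiple zeta value `ζ(k₁,…,k_r) = Σ_{0<v₁<⋯<v_r} v₁^{−k₁}⋯v_r^{−k_r}`. -/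
noncomputable def mzv {r : ℕ} (k : Fin r → ℕ) : ℝ :=
  ∑' v : {v : Fin r → ℕ // (∀ i, 0 < v i) ∧ StrictMono v},
    ∏ i, (1 : ℝ) / (v.1 i : ℝ) ^ (k i)

/-- `x` is a multiple zeta value (convergent: `k_r ≥ 2`, all entries `≥ 1`). -/
def IsMZV (x : ℝ) : Prop :=
  ∃ (r : ℕ) (k : Fin (r + 1) → ℕ),
    (∀ i, 1 ≤ k i) ∧ 2 ≤ k (Fin.last r) ∧ x = mzv k

/-- `S(m,n) = Σ_{k₁+⋯+k_m=0, kᵢ≠0} 1/(|k₁⋯k_m|·(|k₁|+⋯+|k_m|)ⁿ)`. -/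
noncomputable def Ssum (m n : ℕ) : ℝ :=
  ∑' k : {k : Fin m → ℤ // (∀ i, k i ≠ 0) ∧ ∑ i, k i = 0},
    1 / ((∏ i, |(k.1 i : ℝ)|) * (∑ i, |(k.1 i : ℝ)|) ^ n)

/-- The power series `-log (1 - x) = ∑ xⁿ / n`. -/
noncomputable def logSeries : PowerSeries ℝ := PowerSeries.mk fun n => (n : ℝ)⁻¹

/-- The polynomial `t (t + 1) ⋯ (t + N - 1) / N!`. -/
noncomputable def risingBinom (N : ℕ) : Polynomial ℝ :=
  Polynomial.C ((N ! : ℝ)⁻¹) * ∏ j ∈ range N, (Polynomial.X + Polynomial.C (j : ℝ))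

lemma one_sub_X_mul_derivative_logSeries :
    (1 - PowerSeries.X) * PowerSeries.derivative ℝ logSeries = 1 := by
  have h : PowerSeries.derivative ℝ logSeries = PowerSeries.mk 1 := by
    ext n
    have : (n : ℝ) + 1 ≠ 0 := by positivity
    simp [PowerSeries.coeff_derivative, logSeries, this]
  rw [h, mul_comm, PowerSeries.mk_one_mul_one_sub_eq_one]

lemma coeff_logSeries_pow_succ (p N : ℕ) :
    ((N : ℝ) + 1) * PowerSeries.coeff (N + 1) (logSeries ^ (p + 1)) =
      N * PowerSeries.coeff N (logSeries ^ (p + 1)) +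
        (p + 1) * PowerSeries.coeff N (logSeries ^ p) := by
  have h : (1 - PowerSeries.X) * PowerSeries.derivative ℝ (logSeries ^ (p + 1)) =
      PowerSeries.C ((p : ℝ) + 1) * logSeries ^ p := by
    rw [Derivation.leibniz_pow]
    have hC : PowerSeries.C ((p : ℝ) + 1) = ((p + 1 : ℕ) : PowerSeries ℝ) := by
      push_cast [map_add, map_natCast, map_one]
      rfl
    rw [Nat.add_sub_cancel, smul_eq_mul, nsmul_eq_mul, hC]
    linear_combination ((p + 1 : ℕ) : PowerSeries ℝ) * logSeries ^ p *
      one_sub_X_mul_derivative_logSeries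
  have h' := congrArg (PowerSeries.coeff N) h
  rw [PowerSeries.coeff_C_mul, sub_mul, one_mul, map_sub] at h'
  rcases N with _ | N
  · rw [PowerSeries.coeff_zero_X_mul, PowerSeries.coeff_derivative] at h'
    push_cast at h' ⊢
    linarith
  · rw [PowerSeries.coeff_succ_X_mul, PowerSeries.coeff_derivative,
      PowerSeries.coeff_derivative] at h'
    push_cast at h' ⊢
    linarith

lemma risingBinom_succ (N : ℕ) :
    Polynomial.C ((N : ℝ) + 1) * risingBinom (N + 1) =
      (Polynomial.X + Polynomial.C (N : ℝ)) * risingBinom N := by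
  have h : ((N : ℝ) + 1) * (((N + 1)! : ℕ) : ℝ)⁻¹ = ((N ! : ℕ) : ℝ)⁻¹ := by
    have : (N : ℝ) + 1 ≠ 0 := by positivity
    rw [Nat.factorial_succ]
    push_cast
    field_simp
  rw [risingBinom, risingBinom, prod_range_succ, ← mul_assoc, ← Polynomial.C_mul, h]
  ring

lemma coeff_logSeries_pow (p N : ℕ) :
    PowerSeries.coeff N (logSeries ^ p) = (p ! : ℝ) * (risingBinom N).coeff p := by
  induction N generalizing p with
  | zero =>
    rcases p with _ | p
    · simp [risingBinom]
    · simp [risingBinom, logSeries, Polynomial.coeff_one]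
  | succ N ih =>
    have hN : (N : ℝ) + 1 ≠ 0 := by positivity
    have h := congrArg (fun q => Polynomial.coeff q p) (risingBinom_succ N)
    simp only [Polynomial.coeff_C_mul, add_mul (Polynomial.X : Polynomial ℝ),
      Polynomial.coeff_add] at h
    apply mul_left_cancel₀ hN
    rcases p with _ | p
    · rw [mul_left_comm, h]
      rcases N with _ | N
      · simp [PowerSeries.coeff_one]
      · have := ih 0
        simp only [pow_zero, PowerSeries.coeff_one] at this
        simp at this
        simp [PowerSeries.coeff_one, ← this]
    · rw [coeff_logSeries_pow_succ, mul_left_comm, h, Polynomial.coeff_X_mul, ih, ih,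
        Nat.factorial_succ]
      push_cast
      ring

lemma risingBinom_eq {N : ℕ} (hN : 0 < N) :
    risingBinom N = Polynomial.C ((N : ℝ)⁻¹) * Polynomial.X *
      ∏ j ∈ Ioo 0 N, (1 + Polynomial.C ((j : ℝ)⁻¹) * Polynomial.X) := by
  induction N, hN using Nat.le_induction with
  | base =>
    have : Ioo 0 1 = (∅ : Finset ℕ) := by decide
    simp [risingBinom, this]
  | succ N hN ih =>
    have hN0 : (N : ℝ) ≠ 0 := by positivity
    have hN1 : (N : ℝ) + 1 ≠ 0 := by positivity
    have hC : Polynomial.C ((N : ℝ) + 1) ≠ 0 := Polynomial.C_ne_zero.mpr hN1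
    apply mul_left_cancel₀ hC
    have hs : Ioo 0 (N + 1) = insert N (Ioo 0 N) := by ext; simp; omega
    rw [risingBinom_succ, ih, hs, prod_insert (by simp)]
    have h1 : Polynomial.C ((N : ℝ) + 1) * Polynomial.C (((N + 1 : ℕ) : ℝ)⁻¹) = 1 := by
      rw [← Polynomial.C_mul]; push_cast; rw [mul_inv_cancel₀ hN1]; simp
    have h2 : Polynomial.C (N : ℝ) * Polynomial.C ((N : ℝ)⁻¹) = 1 := by
      rw [← Polynomial.C_mul, mul_inv_cancel₀ hN0]; simp
    set P := ∏ j ∈ Ioo 0 N, (1 + Polynomial.C ((j : ℝ)⁻¹) * Polynomial.X)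
    linear_combination (Polynomial.X * P) * h2 -
      (Polynomial.X * (1 + Polynomial.C ((N : ℝ)⁻¹) * Polynomial.X) * P) * h1

lemma sum_powerset_coeff_logSeries_pow (m N : ℕ) :
    ∑ P : Finset (Fin m), PowerSeries.coeff N (logSeries ^ #P) *
      PowerSeries.coeff N (logSeries ^ #Pᶜ) = (m ! : ℝ) * (risingBinom N ^ 2).coeff m := by
  have h := sum_powerset_apply_card (x := (univ : Finset (Fin m)))
    (fun p => PowerSeries.coeff N (logSeries ^ p) * PowerSeries.coeff N (logSeries ^ (m - p)))
  simp only [powerset_univ, card_univ, Fintype.card_fin] at h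
  simp only [card_compl, Fintype.card_fin]
  rw [h, sq, Polynomial.coeff_mul, Finset.Nat.sum_antidiagonal_eq_sum_range_succ
    (fun i j => (risingBinom N).coeff i * (risingBinom N).coeff j), mul_sum]
  refine sum_congr rfl fun p hp => ?_
  have hp : p ≤ m := by simpa [Nat.lt_succ_iff] using hp
  rw [coeff_logSeries_pow, coeff_logSeries_pow, ← Nat.choose_mul_factorial_mul_factorial hp]
  push_cast
  rw [nsmul_eq_mul]
  ring

lemma coeff_risingBinom_sq {N : ℕ} (hN : 0 < N) (n : ℕ) :
    (risingBinom N ^ 2).coeff (n + 2) = ((N : ℝ) ^ 2)⁻¹ *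
      (∏ j ∈ Ioo 0 N, (1 + ∑ b : Fin 2, Polynomial.monomial ((b : ℕ) + 1)
        ((2 : ℝ) ^ (1 - (b : ℕ)) * (1 / (j : ℝ) ^ ((b : ℕ) + 1))))).coeff n := by
  have h : risingBinom N ^ 2 = Polynomial.C (((N : ℝ) ^ 2)⁻¹) * ((∏ j ∈ Ioo 0 N,
      (1 + ∑ b : Fin 2, Polynomial.monomial ((b : ℕ) + 1)
        ((2 : ℝ) ^ (1 - (b : ℕ)) * (1 / (j : ℝ) ^ ((b : ℕ) + 1))))) * Polynomial.X ^ 2) := by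
    rw [risingBinom_eq hN, mul_pow, mul_pow, ← prod_pow, ← Polynomial.C_pow, inv_pow]
    rw [mul_assoc, mul_comm (Polynomial.X ^ 2)]
    congr 2
    refine prod_congr rfl fun j _ => ?_
    simp only [Fin.sum_univ_two, ← Polynomial.C_mul_X_pow_eq_monomial]
    simp only [Fin.coe_ofNat_eq_mod, Nat.zero_mod, Nat.mod_succ, zero_add, tsub_zero, pow_one,
      tsub_self, pow_zero, one_mul, one_div, Polynomial.C_mul, Nat.reduceAdd, ← inv_pow,
      Polynomial.C_pow, Polynomial.C_ofNat]
    ring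
  rw [h, Polynomial.coeff_C_mul, Polynomial.coeff_mul_X_pow]

open Classical in
/-- The strictly increasing `r`-tuples with entries in `s`. -/
noncomputable def increasingTuples (r : ℕ) (s : Finset ℕ) : Finset (Fin r → ℕ) :=
  {v ∈ Fintype.piFinset fun _ => s | StrictMono v}

lemma mem_increasingTuples {r : ℕ} {s : Finset ℕ} {v : Fin r → ℕ} :
    v ∈ increasingTuples r s ↔ (∀ i, v i ∈ s) ∧ StrictMono v := by
  simp [increasingTuples]

lemma sum_increasingTuples_prod {R : Type*} [CommSemiring R] (r : ℕ) (s : Finset ℕ) (g : ℕ → R) :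
    ∑ v ∈ increasingTuples r s, ∏ i, g (v i) = ∑ S ∈ powersetCard r s, ∏ j ∈ S, g j := by
  refine sum_bij (fun v _ => univ.image v) ?_ ?_ ?_ ?_
  · intro v hv
    rw [mem_increasingTuples] at hv
    rw [mem_powersetCard, card_image_of_injective _ hv.2.injective]
    refine ⟨fun x hx => ?_, by simp⟩
    obtain ⟨i, -, rfl⟩ := mem_image.mp hx
    exact hv.1 i
  · intro v hv w hw h
    rw [mem_increasingTuples] at hv hw
    have hc : #(univ.image v) = r := by
      rw [card_image_of_injective _ hv.2.injective]; simp
    refine (orderEmbOfFin_unique hc (fun x => mem_image_of_mem v (mem_univ x)) hv.2).trans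
      (orderEmbOfFin_unique hc (fun x => ?_) hw.2).symm
    rw [h]
    exact mem_image_of_mem w (mem_univ x)
  · intro S hS
    obtain ⟨hS, hc⟩ := mem_powersetCard.mp hS
    refine ⟨S.orderEmbOfFin hc, ?_, ?_⟩
    · rw [mem_increasingTuples]
      exact ⟨fun i => hS (orderEmbOfFin_mem S hc i), (S.orderEmbOfFin hc).strictMono⟩
    · apply coe_injective
      simp
  · intro v hv
    rw [mem_increasingTuples] at hv
    rw [prod_image hv.2.injective.injOn]

/-- The truncated multiple zeta sum `∑_{0 < v₁ < ⋯ < v_r < N} v₁^{-k₁} ⋯ v_r^{-k_r}`. -/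
noncomputable def truncSum {r : ℕ} (k : Fin r → ℕ) (N : ℕ) : ℝ :=
  ∑ v ∈ increasingTuples r (Ioo 0 N), ∏ i, (1 : ℝ) / (v i : ℝ) ^ k i

lemma truncSum_nonneg {r : ℕ} (k : Fin r → ℕ) (N : ℕ) : 0 ≤ truncSum k N :=
  sum_nonneg fun _ _ => prod_nonneg fun _ _ => by positivity

lemma prod_one_add_le_sqrt {N : ℕ} (hN : 0 < N) :
    ∏ j ∈ Ioo 0 N, (1 + (1 / 3 : ℝ) * (1 / (j : ℝ))) ≤ √N := by
  induction N, hN using Nat.le_induction with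
  | base =>
    have : Ioo 0 1 = (∅ : Finset ℕ) := by decide
    simp [this]
  | succ N hN ih =>
    have hN0 : (1 : ℝ) ≤ N := by exact_mod_cast hN
    have hs : Ioo 0 (N + 1) = insert N (Ioo 0 N) := by ext; simp; omega
    rw [hs, prod_insert (by simp)]
    refine (mul_le_mul_of_nonneg_left ih (by positivity)).trans ?_
    apply Real.le_sqrt_of_sq_le
    rw [mul_pow, Real.sq_sqrt (by positivity)]
    have : (1 + 1 / 3 * (1 / (N : ℝ))) ^ 2 * N = N + 2 / 3 + 1 / 9 * (1 / N) := by
      field_simp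
      ring
    rw [this]
    have : 1 / (N : ℝ) ≤ 1 := by rw [div_le_one] <;> linarith
    push_cast
    linarith

lemma truncSum_le {r : ℕ} (k : Fin r → ℕ) (hk : ∀ i, 1 ≤ k i) {N : ℕ} (hN : 0 < N) :
    truncSum k N ≤ 3 ^ r * √N := by
  calc truncSum k N
      ≤ ∑ v ∈ increasingTuples r (Ioo 0 N), ∏ i, (1 : ℝ) / (v i : ℝ) := by
        refine sum_le_sum fun v hv => prod_le_prod (fun _ _ => by positivity) fun i _ => ?_
        have hv := (mem_Ioo.mp ((mem_increasingTuples.mp hv).1 i)).1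
        have h1 : (1 : ℝ) ≤ v i := by exact_mod_cast hv
        exact one_div_le_one_div_of_le (by linarith)
          (le_self_pow₀ h1 (Nat.one_le_iff_ne_zero.mp (hk i)))
    _ = 3 ^ r * ∑ S ∈ powersetCard r (Ioo 0 N), ∏ j ∈ S, ((1 / 3 : ℝ) * (1 / (j : ℝ))) := by
        rw [sum_increasingTuples_prod r (Ioo 0 N) (fun j => 1 / (j : ℝ)), mul_sum]
        refine sum_congr rfl fun S hS => ?_
        rw [prod_mul_distrib, prod_const, (mem_powersetCard.mp hS).2, ← mul_assoc, ← mul_pow]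
        norm_num
    _ ≤ 3 ^ r * ∏ j ∈ Ioo 0 N, (1 + (1 / 3 : ℝ) * (1 / (j : ℝ))) := by
        rw [prod_one_add]
        refine mul_le_mul_of_nonneg_left (sum_le_sum_of_subset_of_nonneg ?_ fun S _ _ =>
          prod_nonneg fun j _ => by positivity) (by positivity)
        intro S hS
        exact mem_powerset.mpr (mem_powersetCard.mp hS).1
    _ ≤ 3 ^ r * √N := by
        gcongr
        exact prod_one_add_le_sqrt hN

lemma summable_truncSum_div_pow {r : ℕ} (k : Fin r → ℕ) (hk : ∀ i, 1 ≤ k i) (α : ℕ) :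
    Summable fun N : ℕ => truncSum k N * (1 / (N : ℝ) ^ (α + 2)) := by
  have hs : Summable fun N : ℕ => (3 : ℝ) ^ r * (1 / (N : ℝ) ^ (3 / 2 : ℝ)) :=
    (Real.summable_one_div_nat_rpow.mpr (by norm_num)).mul_left _
  refine hs.of_nonneg_of_le
    (fun N => mul_nonneg (truncSum_nonneg k N) (by positivity)) fun N => ?_
  rcases Nat.eq_zero_or_pos N with rfl | hN
  · simp
  · have h1 : (1 : ℝ) ≤ N := by exact_mod_cast hN
    have h0 : (0 : ℝ) < N := by linarith
    calc truncSum k N * (1 / (N : ℝ) ^ (α + 2))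
        ≤ 3 ^ r * √N * (1 / (N : ℝ) ^ 2) := by
          refine mul_le_mul (truncSum_le k hk hN) ?_ (by positivity) (by positivity)
          exact one_div_le_one_div_of_le (by positivity) (pow_le_pow_right₀ h1 (by omega))
      _ = 3 ^ r * (1 / (N : ℝ) ^ (3 / 2 : ℝ)) := by
          rw [mul_assoc]
          congr 1
          rw [Real.sqrt_eq_rpow, ← Real.rpow_natCast (N : ℝ) 2, one_div (_ ^ _),
            one_div (_ ^ _), ← Real.rpow_neg h0.le, ← Real.rpow_neg h0.le, ← Real.rpow_add h0]
          norm_num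

lemma HasSum.sigma_of_fintype_of_nonneg {T : ℕ → Type*} [∀ N, Fintype (T N)]
    {f : (Σ N, T N) → ℝ} (hf : ∀ x, 0 ≤ f x) {s : ℝ}
    (h : HasSum (fun N => ∑ x, f ⟨N, x⟩) s) : HasSum f s := by
  have hs : Summable f := by
    refine (summable_sigma_of_nonneg hf).mpr ⟨fun N => (hasSum_fintype _).summable, ?_⟩
    simpa only [tsum_fintype] using h.summable
  have h' := hs.hasSum.sigma fun N => hasSum_fintype fun x => f ⟨N, x⟩
  rw [h.unique h']
  exact hs.hasSum

lemma strictMono_snoc {r : ℕ} {v : Fin r → ℕ} {N : ℕ} (hv : StrictMono v) (h : ∀ i, v i < N) :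
    StrictMono (Fin.snoc v N : Fin (r + 1) → ℕ) := by
  intro i j hij
  induction j using Fin.lastCases with
  | last =>
    induction i using Fin.lastCases with
    | last => exact absurd hij (lt_irrefl _)
    | cast i => simpa using h i
  | cast j =>
    induction i using Fin.lastCases with
    | last => exact absurd hij (not_lt.mpr (Fin.le_last _))
    | cast i => simpa using hv (by simpa using hij)

lemma hasSum_mzv_snoc {r : ℕ} (k : Fin r → ℕ) (hk : ∀ i, 1 ≤ k i) (α : ℕ) :
    HasSum (fun N : ℕ => truncSum k N * (1 / (N : ℝ) ^ (α + 2)))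
      (mzv (Fin.snoc k (α + 2) : Fin (r + 1) → ℕ)) := by
  set f : (Σ N : ℕ, {v // v ∈ increasingTuples r (Ioo 0 N)}) → ℝ :=
    fun x => (∏ i, (1 : ℝ) / (x.2.1 i : ℝ) ^ k i) * (1 / (x.1 : ℝ) ^ (α + 2)) with hf
  have h := (summable_truncSum_div_pow k hk α).hasSum
  have hfs : HasSum f (∑' N : ℕ, truncSum k N * (1 / (N : ℝ) ^ (α + 2))) := by
    refine HasSum.sigma_of_fintype_of_nonneg (fun x => mul_nonneg
      (prod_nonneg fun _ _ => by positivity) (by positivity)) ?_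
    convert h using 2 with N
    rw [truncSum, sum_mul]
    exact sum_coe_sort (increasingTuples r (Ioo 0 N))
      fun v => (∏ i, (1 : ℝ) / (v i : ℝ) ^ k i) * (1 / (N : ℝ) ^ (α + 2))
  have hpos : ∀ x : Function.support f, 0 < x.1.1 := by
    rintro ⟨⟨N, v⟩, hx⟩
    rcases Nat.eq_zero_or_pos N with rfl | hN
    · simp [hf] at hx
    · exact hN
  have hmem : ∀ x : Function.support f, (∀ i, (0 < x.1.2.1 i ∧ x.1.2.1 i < x.1.1)) ∧
      StrictMono x.1.2.1 := fun x => by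
    simpa only [mem_Ioo] using mem_increasingTuples.mp x.1.2.2
  let e : Function.support f →
      {v : Fin (r + 1) → ℕ // (∀ i, 0 < v i) ∧ StrictMono v} := fun x =>
    ⟨Fin.snoc x.1.2.1 x.1.1, fun i => by
        induction i using Fin.lastCases with
        | last => simpa using hpos x
        | cast i => simpa using ((hmem x).1 i).1,
      strictMono_snoc (hmem x).2 fun i => ((hmem x).1 i).2⟩
  have key := hasSum_iff_hasSum_of_ne_zero_bij (g := f)
    (f := fun v : {v : Fin (r + 1) → ℕ // (∀ i, 0 < v i) ∧ StrictMono v} =>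
      ∏ i, (1 : ℝ) / (v.1 i : ℝ) ^ ((Fin.snoc k (α + 2) : Fin (r + 1) → ℕ) i))
    (a := ∑' N : ℕ, truncSum k N * (1 / (N : ℝ) ^ (α + 2))) e ?_ ?_ ?_
  · rw [mzv, (key.mpr hfs).tsum_eq]
    exact h
  · rintro ⟨⟨N, v, hv⟩, hx⟩ ⟨⟨M, w, hw⟩, hy⟩ hxy
    have hxy : (Fin.snoc v N : Fin (r + 1) → ℕ) = Fin.snoc w M := congrArg Subtype.val hxy
    obtain ⟨rfl, rfl⟩ := Fin.snoc_injective2 hxy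
    rfl
  · rintro ⟨v, hv0, hv⟩ -
    have hv' : Fin.init v ∈ increasingTuples r (Ioo 0 (v (Fin.last r))) := by
      rw [mem_increasingTuples]
      refine ⟨fun i => mem_Ioo.mpr ⟨hv0 _, hv (Fin.castSucc_lt_last i)⟩, fun i j hij => hv ?_⟩
      simpa using hij
    refine ⟨⟨⟨v (Fin.last r), Fin.init v, hv'⟩, ?_⟩, ?_⟩
    · refine mul_ne_zero (prod_ne_zero_iff.mpr fun i _ => ?_) ?_
      · have : (Fin.init v i : ℝ) ≠ 0 := by exact_mod_cast (hv0 i.castSucc).ne'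
        positivity
      · have : (v (Fin.last r) : ℝ) ≠ 0 := by exact_mod_cast (hv0 _).ne'
        positivity
    · exact Subtype.ext (Fin.snoc_init_self v)
  · intro x
    simp only [e, hf, Fin.prod_univ_castSucc, Fin.snoc_castSucc, Fin.snoc_last]

lemma coeff_prod_one_add (n N : ℕ) :
    (∏ j ∈ Ioo 0 N, (1 + ∑ b : Fin 2, Polynomial.monomial ((b : ℕ) + 1)
        ((2 : ℝ) ^ (1 - (b : ℕ)) * (1 / (j : ℝ) ^ ((b : ℕ) + 1))))).coeff n =
      ∑ r ∈ range (n + 1), ∑ a : Fin r → Fin 2,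
        if ∑ i, ((a i : ℕ) + 1) = n then
          (2 : ℝ) ^ (2 * (r : ℤ) - (n : ℤ)) * truncSum (fun i => (a i : ℕ) + 1) N else 0 := by
  set g : ℕ → Polynomial ℝ := fun j => ∑ b : Fin 2, Polynomial.monomial ((b : ℕ) + 1)
        ((2 : ℝ) ^ (1 - (b : ℕ)) * (1 / (j : ℝ) ^ ((b : ℕ) + 1))) with hg
  have hmon : ∀ {r : ℕ} (e : Fin r → ℕ) (c : Fin r → ℝ),
      ∏ i, Polynomial.monomial (e i) (c i) = Polynomial.monomial (∑ i, e i) (∏ i, c i) := by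
    intro r e c
    simp_rw [← Polynomial.C_mul_X_pow_eq_monomial]
    rw [prod_mul_distrib, prod_pow_eq_pow_sum, map_prod]
  have hr : ∀ r : ℕ, (∑ S ∈ powersetCard r (Ioo 0 N), ∏ j ∈ S, g j).coeff n =
      ∑ a : Fin r → Fin 2, if ∑ i, ((a i : ℕ) + 1) = n then
          (2 : ℝ) ^ (2 * (r : ℤ) - (n : ℤ)) * truncSum (fun i => (a i : ℕ) + 1) N else 0 := by
    intro r
    rw [← sum_increasingTuples_prod]
    simp_rw [hg, prod_univ_sum, Fintype.piFinset_univ, hmon, Polynomial.finsetSum_coeff,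
      Polynomial.coeff_monomial]
    rw [sum_comm]
    refine sum_congr rfl fun a _ => ?_
    split_ifs with ha
    · rw [truncSum, mul_sum]
      refine sum_congr rfl fun v _ => ?_
      rw [prod_mul_distrib, prod_pow_eq_pow_sum]
      congr 1
      have h2 : ∑ i, (1 - (a i : ℕ)) + n = 2 * r := by
        rw [← ha, ← sum_add_distrib]
        have : ∀ i, (1 - (a i : ℕ)) + ((a i : ℕ) + 1) = 2 := fun i => by omega
        simp [this, mul_comm]
      rw [← zpow_natCast]
      congr 1
      omega
    · simp
  change (∏ j ∈ Ioo 0 N, (1 + g j)).coeff n = _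
  rw [prod_one_add, sum_powerset, Polynomial.finsetSum_coeff]
  refine (sum_subset (range_subset_range.mpr (Nat.le_add_right _ (n + 1)))
    fun r _ h => ?_).trans ?_
  · rw [powersetCard_eq_empty.mpr (by simpa using h)]
    simp
  · simp_rw [hr]
    refine (sum_subset (range_subset_range.mpr (Nat.le_add_left _ _)) fun r _ h => ?_).symm
    refine sum_eq_zero fun a _ => if_neg ?_
    have hle : ∑ _i : Fin r, 1 ≤ ∑ i, ((a i : ℕ) + 1) := sum_le_sum fun i _ => by omega
    simp only [sum_const, card_univ, Fintype.card_fin, smul_eq_mul, mul_one] at hle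
    rw [mem_range] at h
    omega

lemma coeff_logSeries_pow_card {m : ℕ} (P : Finset (Fin m)) (N : ℕ) :
    PowerSeries.coeff N (logSeries ^ #P) =
      ∑ l ∈ P.finsuppAntidiag N, ∏ i ∈ P, ((l i : ℕ) : ℝ)⁻¹ := by
  rw [← prod_const, PowerSeries.coeff_prod]
  simp [logSeries]

lemma sum_eq_of_mem_finsuppAntidiag {m : ℕ} {P : Finset (Fin m)} {N : ℕ} {l : Fin m →₀ ℕ}
    (hl : l ∈ P.finsuppAntidiag N) : ∑ i, l i = N := by
  obtain ⟨h, hs⟩ := mem_finsuppAntidiag.mp hl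
  rw [← h]
  refine (sum_subset (subset_univ P) fun i _ hi => ?_).symm
  by_contra h0
  exact hi (hs (Finsupp.mem_support_iff.mpr h0))

lemma eq_zero_of_mem_finsuppAntidiag {m : ℕ} {P : Finset (Fin m)} {N : ℕ} {l : Fin m →₀ ℕ}
    (hl : l ∈ P.finsuppAntidiag N) {i : Fin m} (hi : i ∉ P) : l i = 0 := by
  by_contra h0
  exact hi ((mem_finsuppAntidiag.mp hl).2 (Finsupp.mem_support_iff.mpr h0))

/-- Grouping the summands by the common value `N` of the sum of the positive entries and of the
sum of the absolute values of the negative entries, and then by the set of positive entries. -/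
lemma Ssum_eq_of_hasSum {m α : ℕ} (hm : 0 < m) {s : ℝ}
    (h : HasSum (fun N : ℕ => (∑ P : Finset (Fin m), PowerSeries.coeff N (logSeries ^ #P) *
      PowerSeries.coeff N (logSeries ^ #Pᶜ)) * (1 / (2 * (N : ℝ)) ^ α)) s) : Ssum m α = s := by
  set g : (Σ N : ℕ, Σ P : Finset (Fin m),
      {l // l ∈ P.finsuppAntidiag N ×ˢ Pᶜ.finsuppAntidiag N}) → ℝ := fun x =>
    (∏ i ∈ x.2.1, ((x.2.2.1.1 i : ℕ) : ℝ)⁻¹) * (∏ i ∈ x.2.1ᶜ, ((x.2.2.1.2 i : ℕ) : ℝ)⁻¹) *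
      (1 / (2 * (x.1 : ℝ)) ^ α) with hg
  have hgs : HasSum g s := by
    refine HasSum.sigma_of_fintype_of_nonneg (fun x => by positivity) ?_
    convert h using 2 with N
    rw [Fintype.sum_sigma, sum_mul]
    refine sum_congr rfl fun P _ => ?_
    rw [coeff_logSeries_pow_card, coeff_logSeries_pow_card, sum_mul_sum, ← sum_product', sum_mul]
    exact sum_coe_sort (P.finsuppAntidiag N ×ˢ Pᶜ.finsuppAntidiag N) fun l =>
      (∏ i ∈ P, ((l.1 i : ℕ) : ℝ)⁻¹) * (∏ i ∈ Pᶜ, ((l.2 i : ℕ) : ℝ)⁻¹) * (1 / (2 * (N : ℝ)) ^ α)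
  have facts : ∀ x : Function.support g,
      (∀ i ∈ x.1.2.1, x.1.2.2.1.1 i ≠ 0 ∧ x.1.2.2.1.2 i = 0) ∧
      (∀ i ∉ x.1.2.1, x.1.2.2.1.1 i = 0 ∧ x.1.2.2.1.2 i ≠ 0) ∧
      ∑ i, x.1.2.2.1.1 i = x.1.1 ∧ ∑ i, x.1.2.2.1.2 i = x.1.1 := by
    rintro ⟨⟨N, P, ⟨l₁, l₂⟩, hl⟩, hx⟩
    obtain ⟨h₁, h₂⟩ := mem_product.mp hl
    have hx' := left_ne_zero_of_mul hx
    have hx₁ := prod_ne_zero_iff.mp (left_ne_zero_of_mul hx')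
    have hx₂ := prod_ne_zero_iff.mp (right_ne_zero_of_mul hx')
    refine ⟨fun i hi => ⟨?_, eq_zero_of_mem_finsuppAntidiag h₂ (by simpa using hi)⟩,
      fun i hi => ⟨eq_zero_of_mem_finsuppAntidiag h₁ hi, ?_⟩,
      sum_eq_of_mem_finsuppAntidiag h₁, sum_eq_of_mem_finsuppAntidiag h₂⟩
    · simpa using hx₁ i hi
    · simpa using hx₂ i (by simpa using hi)
  let e : Function.support g → {k : Fin m → ℤ // (∀ i, k i ≠ 0) ∧ ∑ i, k i = 0} := fun x =>
    ⟨fun i => (x.1.2.2.1.1 i : ℤ) - (x.1.2.2.1.2 i : ℤ), fun i => by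
      by_cases hi : i ∈ x.1.2.1
      · beta_reduce
        rw [((facts x).1 i hi).2]
        simpa using ((facts x).1 i hi).1
      · beta_reduce
        rw [((facts x).2.1 i hi).1]
        simpa using ((facts x).2.1 i hi).2, by
      rw [sum_sub_distrib, ← Nat.cast_sum, ← Nat.cast_sum, (facts x).2.2.1, (facts x).2.2.2,
        sub_self]⟩
  have key := hasSum_iff_hasSum_of_ne_zero_bij (g := g)
    (f := fun k : {k : Fin m → ℤ // (∀ i, k i ≠ 0) ∧ ∑ i, k i = 0} =>
      1 / ((∏ i, |(k.1 i : ℝ)|) * (∑ i, |(k.1 i : ℝ)|) ^ α)) (a := s) e ?_ ?_ ?_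
  · exact (key.mpr hgs).tsum_eq
  · intro x y hxy
    have hxy' : ∀ i, (x.1.2.2.1.1 i : ℤ) - (x.1.2.2.1.2 i : ℤ) =
      (y.1.2.2.1.1 i : ℤ) - (y.1.2.2.1.2 i : ℤ) := congrFun (congrArg Subtype.val hxy)
    have fx := facts x
    have fy := facts y
    obtain ⟨⟨N, P, ⟨l₁, l₂⟩, hl⟩, hx⟩ := x
    obtain ⟨⟨M, Q, ⟨k₁, k₂⟩, hk⟩, hy⟩ := y
    dsimp only at fx fy hxy'
    have hall : ∀ i, (i ∈ P ↔ i ∈ Q) ∧ l₁ i = k₁ i ∧ l₂ i = k₂ i := by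
      intro i
      have := hxy' i
      by_cases hP : i ∈ P <;> by_cases hQ : i ∈ Q
      · have h1 := fx.1 i hP
        have h2 := fy.1 i hQ
        exact ⟨by simp [hP, hQ], by omega, by omega⟩
      · have h1 := fx.1 i hP
        have h2 := fy.2.1 i hQ
        omega
      · have h1 := fx.2.1 i hP
        have h2 := fy.1 i hQ
        omega
      · have h1 := fx.2.1 i hP
        have h2 := fy.2.1 i hQ
        exact ⟨by simp [hP, hQ], by omega, by omega⟩
    obtain rfl : P = Q := Finset.ext fun i => (hall i).1
    obtain rfl : l₁ = k₁ := Finsupp.ext fun i => (hall i).2.1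
    obtain rfl : l₂ = k₂ := Finsupp.ext fun i => (hall i).2.2
    obtain rfl : N = M := fx.2.2.1.symm.trans fy.2.2.1
    rfl
  · rintro ⟨k, hk0, hk⟩ -
    let P : Finset (Fin m) := {i | 0 < k i}
    let l₁ : Fin m →₀ ℕ := Finsupp.equivFunOnFinite.symm fun i => (k i).toNat
    let l₂ : Fin m →₀ ℕ := Finsupp.equivFunOnFinite.symm fun i => (-k i).toNat
    have hP : ∀ i, i ∈ P ↔ 0 < k i := by simp [P]
    have e₁ : ∀ i, l₁ i = (k i).toNat := fun i => rfl
    have e₂ : ∀ i, l₂ i = (-k i).toNat := fun i => rfl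
    have hs₁ : ∑ i ∈ P, l₁ i = ∑ i, l₁ i :=
      sum_subset (subset_univ P) fun i _ hi => by rw [hP] at hi; rw [e₁]; omega
    have hs₂ : ∑ i ∈ Pᶜ, l₂ i = ∑ i, l₂ i :=
      sum_subset (subset_univ Pᶜ) fun i _ hi => by
        rw [mem_compl, not_not, hP] at hi; rw [e₂]; omega
    have hs : ∑ i, l₂ i = ∑ i, l₁ i := by
      have : ∑ i, ((l₁ i : ℤ) - (l₂ i : ℤ)) = ∑ i, k i :=
        sum_congr rfl fun i _ => by rw [e₁, e₂]; omega
      rw [hk, sum_sub_distrib, ← Nat.cast_sum, ← Nat.cast_sum] at this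
      omega
    have hm₁ : l₁ ∈ P.finsuppAntidiag (∑ i, l₁ i) := by
      rw [mem_finsuppAntidiag]
      refine ⟨hs₁, fun i hi => ?_⟩
      rw [Finsupp.mem_support_iff, e₁] at hi
      rw [hP]
      omega
    have hm₂ : l₂ ∈ Pᶜ.finsuppAntidiag (∑ i, l₁ i) := by
      rw [mem_finsuppAntidiag]
      refine ⟨hs₂.trans hs, fun i hi => ?_⟩
      rw [Finsupp.mem_support_iff, e₂] at hi
      rw [mem_compl, hP]
      omega
    refine ⟨⟨⟨∑ i, l₁ i, P, (l₁, l₂), mem_product.mpr ⟨hm₁, hm₂⟩⟩, ?_⟩, ?_⟩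
    · have h₁ : ∀ i ∈ P, ((l₁ i : ℕ) : ℝ)⁻¹ ≠ 0 := fun i hi => by
        rw [hP] at hi
        have : l₁ i ≠ 0 := by rw [e₁]; omega
        positivity
      have h₂ : ∀ i ∈ Pᶜ, ((l₂ i : ℕ) : ℝ)⁻¹ ≠ 0 := fun i hi => by
        rw [mem_compl, hP] at hi
        have := hk0 i
        have : l₂ i ≠ 0 := by rw [e₂]; omega
        positivity
      refine mul_ne_zero (mul_ne_zero (prod_ne_zero_iff.mpr h₁) (prod_ne_zero_iff.mpr h₂)) ?_
      have hpos : ∑ i, l₁ i ≠ 0 := fun h0 => by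
        have h₁ := (sum_eq_zero_iff.mp h0) ⟨0, hm⟩ (mem_univ _)
        have h₂ := (sum_eq_zero_iff.mp (hs.trans h0)) ⟨0, hm⟩ (mem_univ _)
        have := hk0 ⟨0, hm⟩
        rw [e₁] at h₁
        rw [e₂] at h₂
        omega
      have : ((∑ i, l₁ i : ℕ) : ℝ) ≠ 0 := by exact_mod_cast hpos
      exact one_div_ne_zero (pow_ne_zero _ (mul_ne_zero two_ne_zero this))
    · refine Subtype.ext (funext fun i => ?_)
      simp only [e, e₁, e₂]
      omega
  · intro x
    obtain ⟨f₁, f₂, f₃, f₄⟩ := facts x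
    have habs : ∀ i, |(((e x).1 i : ℤ) : ℝ)| = (x.1.2.2.1.1 i : ℝ) + (x.1.2.2.1.2 i : ℝ) := by
      intro i
      by_cases hi : i ∈ x.1.2.1
      · simp [e, (f₁ i hi).2]
      · simp [e, (f₂ i hi).1]
    simp only [habs, hg]
    rw [sum_add_distrib, ← Nat.cast_sum, ← Nat.cast_sum, f₃, f₄, ← two_mul, one_div, mul_inv,
      ← prod_inv_distrib, ← prod_mul_prod_compl x.1.2.1, one_div]
    congr 2
    · exact prod_congr rfl fun i hi => by simp [(f₁ i hi).2]
    · exact prod_congr rfl fun i hi => by simp [(f₂ i (mem_compl.mp hi)).1]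

lemma Ssum_eq (m α : ℕ) (hm : 2 ≤ m) :
    Ssum m α = (m ! : ℝ) *
        ∑ r ∈ Finset.range (m - 1), ∑ a : Fin r → Fin 2,
          (if (∑ i, ((a i : ℕ) + 1)) = m - 2 then
            (2 : ℝ) ^ (2 * ((r : ℤ) + 1) - (m : ℤ) - (α : ℤ)) *
              mzv (Fin.snoc (fun i => (a i : ℕ) + 1) (α + 2))
          else 0) := by
  obtain ⟨n, rfl⟩ := Nat.exists_eq_add_of_le' hm
  apply Ssum_eq_of_hasSum (by omega)
  have h : HasSum (fun N : ℕ => ((n + 2)! : ℝ) * ∑ r ∈ range (n + 1), ∑ a : Fin r → Fin 2,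
      if ∑ i, ((a i : ℕ) + 1) = n then
        (2 : ℝ) ^ (2 * ((r : ℤ) + 1) - ((n + 2 : ℕ) : ℤ) - (α : ℤ)) *
          (truncSum (fun i => (a i : ℕ) + 1) N * (1 / (N : ℝ) ^ (α + 2))) else 0)
      (((n + 2)! : ℝ) * ∑ r ∈ range (n + 1), ∑ a : Fin r → Fin 2,
        if ∑ i, ((a i : ℕ) + 1) = n then
          (2 : ℝ) ^ (2 * ((r : ℤ) + 1) - ((n + 2 : ℕ) : ℤ) - (α : ℤ)) *
            mzv (Fin.snoc (fun i => (a i : ℕ) + 1) (α + 2) : Fin (r + 1) → ℕ) else 0) := by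
    refine (hasSum_sum fun r _ => hasSum_sum fun a _ => ?_).mul_left _
    split_ifs
    · exact (hasSum_mzv_snoc _ (fun i => by omega) α).mul_left _
    · exact hasSum_zero
  refine h.congr_fun fun N => ?_
  rw [sum_powerset_coeff_logSeries_pow, mul_assoc]
  congr 1
  rcases Nat.eq_zero_or_pos N with rfl | hN
  · simp [risingBinom, Polynomial.coeff_one]
  · have hN0 : (N : ℝ) ≠ 0 := by positivity
    rw [coeff_risingBinom_sq hN, coeff_prod_one_add, mul_right_comm, mul_sum]
    refine sum_congr rfl fun r _ => ?_
    rw [mul_sum]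
    refine sum_congr rfl fun a _ => ?_
    split_ifs
    · have he : 2 * ((r : ℤ) + 1) - ((n + 2 : ℕ) : ℤ) - (α : ℤ) = 2 * (r : ℤ) - n - α := by
        push_cast
        ring
      rw [he, zpow_sub₀ two_ne_zero _ (α : ℤ), zpow_natCast]
      field_simp
      ring
    · simp

/-- Zagier's formula:
`S(m,α) = m! · Σ_{r=0}^{m−2} Σ_{a ∈ {1,2}^r, Σa = m−2} 2^{2(r+1)−m−α} · ζ(a₁,…,a_r,α+2)`;
in particular `S(m,α)` lies in the `ℚ`-span of the multiple zeta values. -/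
theorem Ssum_eq_sum_mzv (m α : ℕ) (hm : 2 ≤ m) :
    (Ssum m α = (m ! : ℝ) *
        ∑ r ∈ Finset.range (m - 1), ∑ a : Fin r → Fin 2,
          (if (∑ i, ((a i : ℕ) + 1)) = m - 2 then
            (2 : ℝ) ^ (2 * ((r : ℤ) + 1) - (m : ℤ) - (α : ℤ)) *
              mzv (Fin.snoc (fun i => (a i : ℕ) + 1) (α + 2))
          else 0)) ∧
      Ssum m α ∈ Submodule.span ℚ {x : ℝ | IsMZV x} := by
  refine ⟨Ssum_eq m α hm, ?_⟩
  rw [Ssum_eq m α hm, ← nsmul_eq_mul]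
  refine Submodule.smul_of_tower_mem _ _ (Submodule.sum_mem _ fun r _ =>
    Submodule.sum_mem _ fun a _ => ?_)
  split_ifs
  · have hq : ((2 : ℝ) ^ (2 * ((r : ℤ) + 1) - (m : ℤ) - (α : ℤ))) =
        (((2 : ℚ) ^ (2 * ((r : ℤ) + 1) - (m : ℤ) - (α : ℤ)) : ℚ) : ℝ) := by push_cast; rfl
    rw [hq, ← Rat.smul_def]
    refine Submodule.smul_mem _ _ (Submodule.subset_span ⟨r, _, fun i => ?_, ?_, rfl⟩)
    · induction i using Fin.lastCases with
      | last => simp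
      | cast i => simp
    · simp
  · exact Submodule.zero_mem _
end

section
/- Let A be a matrix with entries in {0,1} such that, after some permutation of its rows, in every column the entries equal to 1 occur in consecutive rows. Then A is totally unimodular: every square submatrix of A has determinant equal to 0, 1 or −1. -/
/-- A column of `B` whose first entry is `1` and which has the fewest ones lies entrywise below
every other column whose first entry is `1`. -/
theorem exists_least_initial_column {k : ℕ} {ι : Type*} [Finite ι]
    (B : Matrix (Fin (k + 1)) ι ℤ) (h01 : ∀ i j, B i j = 0 ∨ B i j = 1)
    (hcons : ∀ j, ∀ i₁ i₂ i₃, i₁ ≤ i₂ → i₂ ≤ i₃ → B i₁ j = 1 → B i₃ j = 1 → B i₂ j = 1)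
    (hne : ∃ j, B 0 j = 1) :
    ∃ j₀, B 0 j₀ = 1 ∧ ∀ j, B 0 j = 1 → ∀ i, B i j₀ ≤ B i j := by
  obtain ⟨j₀, hj₀, hmin⟩ := Set.exists_min_image {j | B 0 j = 1} (fun j => ∑ i, B i j)
    (Set.toFinite _) hne
  refine ⟨j₀, hj₀, fun j hj i => ?_⟩
  by_contra! hlt
  have hij₀ : B i j₀ = 1 := by grind
  have hij : B i j = 0 := by grind
  refine (hmin j hj).not_gt (Finset.sum_lt_sum (fun i' _ => ?_) ⟨i, Finset.mem_univ i, hlt⟩)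
  rcases h01 i' j with h | h
  · grind
  · have hle : i' ≤ i := by
      by_contra! hi
      have := hcons j 0 i i' (Fin.zero_le i) hi.le hj h
      omega
    rw [h, hcons j₀ 0 i' i (Fin.zero_le i') hle hj₀ hij₀]

/-- A square `{0,1}`-matrix in which the ones of every column are consecutive has determinant
`0`, `1` or `-1`. -/
theorem det_of_consecutive_ones {k : ℕ} (B : Matrix (Fin k) (Fin k) ℤ)
    (h01 : ∀ i j, B i j = 0 ∨ B i j = 1)
    (hcons : ∀ j, ∀ i₁ i₂ i₃, i₁ ≤ i₂ → i₂ ≤ i₃ → B i₁ j = 1 → B i₃ j = 1 → B i₂ j = 1) :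
    B.det = 0 ∨ B.det = 1 ∨ B.det = -1 := by
  induction k with
  | zero => simp
  | succ k ih =>
    by_cases hne : ∃ j, B 0 j = 1
    · obtain ⟨j₀, hj₀, hle⟩ := exists_least_initial_column B h01 hcons hne
      let c : Fin (k + 1) → ℤ := fun j => if j = j₀ then 0 else -B 0 j
      let C : Matrix (Fin (k + 1)) (Fin (k + 1)) ℤ := Matrix.of fun i j => B i j + c j * B i j₀
      have hdet : C.det = B.det := by
        rw [← Matrix.det_transpose C, ← Matrix.det_transpose B]
        exact Matrix.det_eq_of_forall_row_eq_smul_add_const c j₀ (by simp [c]) fun j i => rfl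
      have hrow : ∀ j, C 0 j = if j = j₀ then 1 else 0 := by
        intro j
        by_cases h : j = j₀ <;> simp [C, c, h, hj₀]
      have hC : ∀ i j, j ≠ j₀ → C i j = B i j - B 0 j * B i j₀ := by
        intro i j h
        simp [C, c, h, sub_eq_add_neg]
      have hminor := ih (C.submatrix Fin.succ j₀.succAbove)
        (by
          intro i j
          rw [Matrix.submatrix_apply, hC _ _ (Fin.succAbove_ne j₀ j)]
          rcases h01 0 (j₀.succAbove j) with h | h
          · simpa [h] using h01 i.succ (j₀.succAbove j)
          · have := hle _ h i.succ
            grind)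
        (by
          intro j i₁ i₂ i₃ h₁₂ h₂₃ h₁ h₃
          have hj := Fin.succAbove_ne j₀ j
          rw [Matrix.submatrix_apply, hC _ _ hj] at h₁ h₃ ⊢
          have h₁₂' := Fin.succ_le_succ_iff.mpr h₁₂
          have h₂₃' := Fin.succ_le_succ_iff.mpr h₂₃
          have hcj := hcons (j₀.succAbove j) _ _ _ h₁₂' h₂₃'
          have hcj₀ := hcons j₀ _ _ _ (Fin.zero_le i₁.succ) h₁₂' hj₀
          rcases h01 0 (j₀.succAbove j) with h | h
          · rw [h] at h₁ h₃ ⊢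
            grind
          · rw [h] at h₁ h₃ ⊢
            grind)
      have hexp : C.det = (-1) ^ (j₀ : ℕ) * (C.submatrix Fin.succ j₀.succAbove).det := by
        rw [Matrix.det_succ_row_zero]
        simp [hrow]
      rw [← hdet, hexp]
      rcases neg_one_pow_eq_or ℤ (j₀ : ℕ) with h | h <;> rw [h] <;> omega
    · left
      push Not at hne
      exact Matrix.det_eq_zero_of_row_eq_zero 0 fun j => (h01 0 j).resolve_right (hne j)

/-- A `{0,1}`-matrix with the consecutive-ones property on columns (after a
suitable permutation of the rows) is totally unimodular: every square submatrix has determinant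
`0`, `1` or `−1`. -/
theorem consecutive_ones_totally_unimodular (m n : ℕ) (A : Matrix (Fin m) (Fin n) ℤ)
    (h01 : ∀ i j, A i j = 0 ∨ A i j = 1)
    (σ : Equiv.Perm (Fin m))
    (hcons : ∀ j : Fin n, ∀ i₁ i₂ i₃ : Fin m, i₁ ≤ i₂ → i₂ ≤ i₃ →
      A (σ i₁) j = 1 → A (σ i₃) j = 1 → A (σ i₂) j = 1) :
    ∀ (k : ℕ) (rows : Fin k → Fin m) (cols : Fin k → Fin n),
      Function.Injective rows → Function.Injective cols →
        (A.submatrix rows cols).det = 0 ∨ (A.submatrix rows cols).det = 1 ∨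
          (A.submatrix rows cols).det = -1 := by
  intro k rows cols _ _
  let pos : Fin k → Fin m := fun i => σ.symm (rows i)
  let τ : Equiv.Perm (Fin k) := Tuple.sort pos
  have hmono : Monotone (pos ∘ τ) := Tuple.monotone_sort pos
  have hsorted := det_of_consecutive_ones ((A.submatrix rows cols).submatrix τ id)
    (fun i j => h01 _ _)
    (by
      intro j i₁ i₂ i₃ h₁₂ h₂₃
      simpa [pos] using hcons (cols j) _ _ _ (hmono h₁₂) (hmono h₂₃))
  rw [Matrix.det_permute] at hsorted
  rcases Int.units_eq_one_or (Equiv.Perm.sign τ) with h | h <;> rw [h] at hsorted <;>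
    push_cast at hsorted <;> omega
end
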